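/- arXiv:2509.25628 — 6 statements merged into one kernel-verified Lean document; each statement's English description precedes it below -/
import Mathlib

section
/- Let f : ℤ₊ → (0,1] be an arbitrary function. Then there exist a real number γ ∈ (0,1) and a function g : ℤ₊ → (0,1] with 0 < g(x) < f(x) for all x ∈ ℤ₊, such that for every real number α the following holds: if the inequality |α − p/q| < γ·f(q)/q² has infinitely many solutions in rationals p/q (with q ∈ ℤ₊, p ∈ ℤ), then the stronger inequality |α − p/q| < (γ·f(q) − g(q))/q² also has infinitely many solutions in rationals p/q. -/
open Filter Topology in
/-- The reals with a rational approximation of denominator larger than `N` and quality `ψ`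
form a dense open set, for every positive `ψ`. -/
theorem isOpen_dense_approximable (ψ : ℕ → ℝ) (hψ : ∀ q : ℕ, 1 ≤ q → 0 < ψ q) (N : ℕ) :
    IsOpen {x : ℝ | ∃ (p : ℤ) (q : ℕ), N < q ∧ |x - (p : ℝ) / q| < ψ q} ∧
      Dense {x : ℝ | ∃ (p : ℤ) (q : ℕ), N < q ∧ |x - (p : ℝ) / q| < ψ q} := by
  constructor
  · have h : {x : ℝ | ∃ (p : ℤ) (q : ℕ), N < q ∧ |x - (p : ℝ) / q| < ψ q} =
        ⋃ (p : ℤ), ⋃ (q : ℕ), ⋃ (_ : N < q), Metric.ball ((p : ℝ) / q) (ψ q) := by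
      ext x
      simp [Real.dist_eq]
    rw [h]
    exact isOpen_iUnion fun p => isOpen_iUnion fun q => isOpen_iUnion fun _ => Metric.isOpen_ball
  · refine (Rat.denseRange_cast (𝕜 := ℝ)).mono ?_
    rintro _ ⟨r, rfl⟩
    have hd : 0 < r.den := r.den_pos
    refine ⟨r.num * (N + 1), r.den * (N + 1), by nlinarith, ?_⟩
    have hr : (r : ℝ) = (r.num : ℝ) / (r.den : ℝ) := Rat.cast_def r
    have hN : (N : ℝ) + 1 ≠ 0 := by positivity
    have hz : (r : ℝ) - ((r.num * (N + 1) : ℤ) : ℝ) / ((r.den * (N + 1) : ℕ) : ℝ) = 0 := by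
      push_cast
      rw [mul_div_mul_right _ _ hN, ← hr, sub_self]
    rw [hz, abs_zero]
    exact hψ _ (Nat.mul_pos hd N.succ_pos)

/-- Countably many nonconstant affine maps simultaneously send some point of a given interval
into all members of a sequence of dense open sets. -/
theorem exists_mem_Ioo_forall_affine_mem {ι : Type*} [Countable ι] (a b : ι → ℝ)
    (hb : ∀ i, b i ≠ 0) (V : ℕ → Set ℝ) (ho : ∀ n, IsOpen (V n)) (hd : ∀ n, Dense (V n))
    {l u : ℝ} (hlu : l < u) : ∃ γ ∈ Set.Ioo l u, ∀ i n, a i + b i * γ ∈ V n := by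
  let φ : ι → ℝ ≃ₜ ℝ := fun i => (Homeomorph.mulLeft₀ (b i) (hb i)).trans (Homeomorph.addLeft (a i))
  have hdense : Dense (⋂ j : ι × ℕ, φ j.1 ⁻¹' V j.2) :=
    dense_iInter_of_isOpen (fun j => (ho j.2).preimage (φ j.1).continuous)
      (fun j => (hd j.2).preimage (φ j.1).isOpenMap)
  obtain ⟨γ, hγ, hmem⟩ := hdense.exists_mem_open isOpen_Ioo (Set.nonempty_Ioo.2 hlu)
  exact ⟨γ, hmem, fun i n => Set.mem_iInter.1 hγ (i, n)⟩

/-- The rationals `p / q` at distance less than `ψ q / q ^ 2` from `α`. -/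
def approximants (ψ : ℕ → ℝ) (α : ℝ) : Set ℚ :=
  {r : ℚ | ∃ (p : ℤ) (q : ℕ), 0 < q ∧ r = (p : ℚ) / (q : ℚ) ∧
    |α - (p : ℝ) / (q : ℝ)| < ψ q / (q : ℝ) ^ 2}

theorem div_sq_le_one {c : ℝ} (hc : c ≤ 1) {q : ℕ} (hq : 0 < q) : c / (q : ℝ) ^ 2 ≤ 1 := by
  have : (1 : ℝ) ≤ q := by exact_mod_cast hq
  rw [div_le_one (by positivity)]
  nlinarith

theorem abs_num_le {α x : ℝ} {p : ℤ} {q : ℕ} (hq : 0 < q) (hx : x ≤ 1)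
    (h : |α - (p : ℝ) / q| < x) : |(p : ℝ)| ≤ (|α| + 1) * q := by
  have hq' : (0 : ℝ) < q := by exact_mod_cast hq
  have h1 : |(p : ℝ) / q| ≤ |α| + 1 := by
    have := abs_sub_abs_le_abs_sub ((p : ℝ) / q) α
    rw [abs_sub_comm] at this
    linarith
  rwa [abs_div, abs_of_pos hq', div_le_iff₀ hq'] at h1

theorem exists_denominator_gt_of_infinite {ψ : ℕ → ℝ} (hψ : ∀ q, 1 ≤ q → ψ q ≤ 1) {α : ℝ}
    (h : (approximants ψ α).Infinite) (N : ℕ) :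
    ∃ (p : ℤ) (q : ℕ), N < q ∧ (p : ℝ) / q ≠ α ∧ |α - (p : ℝ) / q| < ψ q / (q : ℝ) ^ 2 := by
  by_contra! hcon
  refine h ?_
  let M : ℤ := ⌈(|α| + 1) * N⌉
  have hfin : ((fun z : ℤ × ℕ => (z.1 : ℚ) / (z.2 : ℚ)) ''
      (Set.Icc (-M) M ×ˢ Set.Iic N)).Finite :=
    ((Set.finite_Icc _ _).prod (Set.finite_Iic _)).image _
  have hα : {r : ℚ | (r : ℝ) = α}.Finite :=
    Set.Subsingleton.finite fun r hr s hs => by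
      have : (r : ℝ) = s := Eq.trans hr (Eq.symm hs)
      exact_mod_cast this
  refine (hfin.union hα).subset ?_
  rintro r ⟨p, q, hq, rfl, hlt⟩
  by_cases hpq : (p : ℝ) / q = α
  · right
    simpa using hpq
  · left
    have hqN : q ≤ N := by
      by_contra! hNq
      exact absurd hlt (not_lt.2 (hcon p q hNq hpq))
    refine ⟨(p, q), ⟨?_, hqN⟩, rfl⟩
    have h1 := abs_num_le hq (div_sq_le_one (hψ q hq) hq) hlt
    have h2 : (|α| + 1) * q ≤ (|α| + 1) * N := by gcongr
    have h3 : |(p : ℝ)| ≤ (M : ℝ) := (h1.trans h2).trans (Int.le_ceil _)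
    exact abs_le.1 (by exact_mod_cast h3)

theorem irrational_of_infinite_approximants {ψ : ℕ → ℝ} (hψ : ∀ q, 1 ≤ q → ψ q ≤ 1) {α : ℝ}
    (h : (approximants ψ α).Infinite) : Irrational α := by
  rintro ⟨r, rfl⟩
  obtain ⟨p, q, hq, hne, hlt⟩ := exists_denominator_gt_of_infinite hψ h r.den
  have hd : 0 < r.den := r.den_pos
  have hd' : (0 : ℝ) < r.den := by exact_mod_cast hd
  have hq0 : 0 < q := by lia
  have hq' : (0 : ℝ) < q := by exact_mod_cast hq0
  have hr : (r : ℝ) = (r.num : ℝ) / (r.den : ℝ) := Rat.cast_def r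
  have heq : (r : ℝ) - (p : ℝ) / q = ((r.num * q - p * r.den : ℤ) : ℝ) / (r.den * q) := by
    rw [hr]
    push_cast
    field_simp
  have hnum : r.num * q - p * r.den ≠ 0 := by
    intro h0
    rw [h0, Int.cast_zero, zero_div, sub_eq_zero] at heq
    exact hne heq.symm
  have h1 : (1 : ℝ) ≤ |((r.num * q - p * r.den : ℤ) : ℝ)| := by
    exact_mod_cast Int.one_le_abs hnum
  rw [heq, abs_div, abs_of_pos (mul_pos hd' hq'), div_lt_div_iff₀ (by positivity) (by positivity)]
    at hlt
  have h2 : ψ q * (r.den * q) ≤ 1 * (r.den * q) :=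
    mul_le_mul_of_nonneg_right (hψ q hq0) (by positivity)
  have h3 : (r.den : ℝ) < q := by exact_mod_cast hq
  nlinarith [mul_pos hq' (sub_pos.2 h3), mul_le_mul_of_nonneg_right h1 (sq_nonneg (q : ℝ))]

theorem infinite_approximants {ψ : ℕ → ℝ} (hψ : ∀ q, 1 ≤ q → ψ q ≤ 1) {α : ℝ}
    (hα : Irrational α)
    (h : ∀ N : ℕ, ∃ (p : ℤ) (q : ℕ), N < q ∧ |α - (p : ℝ) / q| < ψ q / (q : ℝ) ^ 2) :
    (approximants ψ α).Infinite := by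
  intro hfin
  have hev : ∀ᶠ ε in nhdsWithin (0 : ℝ) (Set.Ioi 0), ∀ r ∈ approximants ψ α, ε < |α - r| := by
    rw [Filter.eventually_all_finite hfin]
    intro r _
    have : 0 < |α - r| := abs_pos.2 (sub_ne_zero.2 (hα.ne_rat r))
    filter_upwards [Ioo_mem_nhdsGT this] with ε hε using hε.2
  obtain ⟨ε, hε, hε0⟩ := (hev.and self_mem_nhdsWithin).exists
  obtain ⟨N, hN⟩ := exists_nat_gt (1 / ε)
  obtain ⟨p, q, hq, hlt⟩ := h N
  have hε0' : 0 < ε := hε0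
  have hq0 : 0 < q := by lia
  have h1 := hε ((p : ℚ) / q) ⟨p, q, hq0, rfl, hlt⟩
  push_cast at h1
  have hq1 : (1 : ℝ) ≤ q := by exact_mod_cast hq0
  have hNq : (N : ℝ) < q := by exact_mod_cast hq
  have h2 : 1 < ε * q := by
    rw [div_lt_iff₀ hε0'] at hN
    nlinarith
  have h3 : ε < ψ q / (q : ℝ) ^ 2 := h1.trans hlt
  rw [lt_div_iff₀ (by positivity)] at h3
  nlinarith [hψ q hq0]

open Filter Topology in
/-- If the points `e p s` have approximations of arbitrarily large denominator, then so do, with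
one denominator larger than `q`, all points near finitely many of them. -/
theorem exists_uniform_radius (ψ : ℕ → ℝ) (hψ : ∀ q : ℕ, 1 ≤ q → 0 < ψ q) (e : ℤ → ℤˣ → ℝ)
    (q : ℕ) (M : ℤ) {c : ℝ} (hc : 0 < c)
    (he : ∀ p s, ∃ (p' : ℤ) (q' : ℕ), q < q' ∧ |e p s - (p' : ℝ) / q'| < ψ q') :
    ∃ G : ℝ, 0 < G ∧ G ≤ c ∧ ∀ p ∈ Finset.Icc (-M) M, ∀ s, ∀ x : ℝ, |x - e p s| ≤ G →
      ∃ (p' : ℤ) (q' : ℕ), q < q' ∧ |x - (p' : ℝ) / q'| < ψ q' := by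
  have hev : ∀ᶠ G in 𝓝[>] (0 : ℝ), ∀ p ∈ Finset.Icc (-M) M, ∀ s, ∀ x : ℝ, |x - e p s| ≤ G →
      ∃ (p' : ℤ) (q' : ℕ), q < q' ∧ |x - (p' : ℝ) / q'| < ψ q' := by
    rw [Filter.eventually_all_finset]
    intro p _
    rw [Filter.eventually_all]
    intro s
    obtain ⟨δ, hδ, hball⟩ := Metric.isOpen_iff.1 (isOpen_dense_approximable ψ hψ q).1 _ (he p s)
    filter_upwards [Ioo_mem_nhdsGT hδ] with G hG x hx
    exact hball (by rw [Metric.mem_ball, Real.dist_eq]; exact hx.trans_lt hG.2)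
  obtain ⟨G, hG, hG0⟩ := (hev.and (Ioc_mem_nhdsGT hc)).exists
  exact ⟨G, hG0.1, hG0.2, hG⟩


/-- Theorem 1: for an arbitrary `f : ℤ₊ → (0,1]` there are `γ ∈ (0,1)` and
`g : ℤ₊ → (0,1]` with `0 < g x < f x`, such that for every real `α`, if
`|α − p/q| < γ·f(q)/q²` has infinitely many rational solutions `p/q`, then so does
`|α − p/q| < (γ·f(q) − g(q))/q²`. -/
theorem statement0 (f : ℕ → ℝ) (hf : ∀ x : ℕ, 1 ≤ x → f x ∈ Set.Ioc (0:ℝ) 1) :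
    ∃ γ ∈ Set.Ioo (0:ℝ) 1, ∃ g : ℕ → ℝ,
      (∀ x : ℕ, 1 ≤ x → g x ∈ Set.Ioc (0:ℝ) 1 ∧ g x < f x) ∧
      ∀ α : ℝ,
        {r : ℚ | ∃ (p : ℤ) (q : ℕ), 0 < q ∧ r = (p : ℚ) / (q : ℚ) ∧
          |α - (p : ℝ) / (q : ℝ)| < γ * f q / (q : ℝ) ^ 2}.Infinite →
        {r : ℚ | ∃ (p : ℤ) (q : ℕ), 0 < q ∧ r = (p : ℚ) / (q : ℚ) ∧
          |α - (p : ℝ) / (q : ℝ)| < (γ * f q - g q) / (q : ℝ) ^ 2}.Infinite := by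
  let ψ : ℕ → ℝ := fun q => f q / 4 / (q : ℝ) ^ 2
  have hψ : ∀ q : ℕ, 1 ≤ q → 0 < ψ q := fun q hq => by
    have h1 : (0 : ℝ) < q := by exact_mod_cast hq
    have h2 := (hf q hq).1
    positivity
  obtain ⟨γ, ⟨hγ1, hγ2⟩, hγ⟩ := exists_mem_Ioo_forall_affine_mem
    (ι := ℤ × ℕ+ × ℤˣ) (fun i => (i.1 : ℝ) / (i.2.1 : ℕ))
    (fun i => ((i.2.2 : ℤ) : ℝ) * (f i.2.1 / ((i.2.1 : ℕ) : ℝ) ^ 2))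
    (fun i => by
      have h1 : (0 : ℝ) < (i.2.1 : ℕ) := by exact_mod_cast i.2.1.pos
      have h2 := (hf i.2.1 i.2.1.pos).1
      have h3 : ((i.2.2 : ℤ) : ℝ) ≠ 0 := by exact_mod_cast i.2.2.ne_zero
      exact mul_ne_zero h3 (by positivity))
    _ (fun N => (isOpen_dense_approximable ψ hψ N).1)
    (fun N => (isOpen_dense_approximable ψ hψ N).2) (show (1 / 2 : ℝ) < 1 by norm_num)
  have hG : ∀ q : ℕ, ∃ G : ℝ, 1 ≤ q → 0 < G ∧ G ≤ f q / 4 ∧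
      ∀ p ∈ Finset.Icc (-((q : ℤ) ^ 2)) ((q : ℤ) ^ 2), ∀ s : ℤˣ, ∀ x : ℝ,
        |x - ((p : ℝ) / q + ((s : ℤ) : ℝ) * (f q / (q : ℝ) ^ 2) * γ)| ≤ G →
        ∃ (p' : ℤ) (q' : ℕ), q < q' ∧ |x - (p' : ℝ) / q'| < ψ q' := fun q => by
    by_cases hq : 1 ≤ q
    · obtain ⟨G, h⟩ := exists_uniform_radius ψ hψ
        (fun p s => (p : ℝ) / q + ((s : ℤ) : ℝ) * (f q / (q : ℝ) ^ 2) * γ) q ((q : ℤ) ^ 2)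
        (c := f q / 4) (by linarith [(hf q hq).1]) (fun p s => hγ (p, ⟨q, hq⟩, s) q)
      exact ⟨G, fun _ => h⟩
    · exact ⟨0, fun h => absurd h hq⟩
  choose g hg using hG
  refine ⟨γ, ⟨by linarith, hγ2⟩, g, fun q hq => ?_, fun α hinf => ?_⟩
  · obtain ⟨h1, h2, -⟩ := hg q hq
    obtain ⟨h3, h4⟩ := hf q hq
    exact ⟨⟨h1, by linarith⟩, by linarith⟩
  have hweak : ∀ q : ℕ, 1 ≤ q → γ * f q ≤ 1 := fun q hq => by
    obtain ⟨h3, h4⟩ := hf q hq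
    nlinarith
  have hstrong : ∀ q : ℕ, 1 ≤ q → γ * f q - g q ≤ 1 := fun q hq => by
    linarith [hweak q hq, (hg q hq).1]
  refine infinite_approximants hstrong (irrational_of_infinite_approximants hweak hinf) fun N => ?_
  obtain ⟨K, hK⟩ := exists_nat_gt (|α| + 1)
  obtain ⟨p, q, hq, -, hlt⟩ := exists_denominator_gt_of_infinite hweak hinf (max N K)
  have hNq : N < q := (le_max_left _ _).trans_lt hq
  have hKq : K < q := (le_max_right _ _).trans_lt hq
  have hq0 : 1 ≤ q := by lia
  by_cases hs : |α - (p : ℝ) / q| < (γ * f q - g q) / (q : ℝ) ^ 2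
  · exact ⟨p, q, hNq, hs⟩
  push Not at hs
  obtain ⟨hg0, -, hgq⟩ := hg q hq0
  have hq1 : (1 : ℝ) ≤ q := by exact_mod_cast hq0
  have hp : p ∈ Finset.Icc (-((q : ℤ) ^ 2)) ((q : ℤ) ^ 2) := by
    have h1 := abs_num_le hq0 (div_sq_le_one (hweak q hq0) hq0) hlt
    have h2 : (K : ℝ) < q := by exact_mod_cast hKq
    have h3 : |(p : ℝ)| ≤ (q : ℝ) ^ 2 := by nlinarith
    rw [Finset.mem_Icc]
    exact abs_le.1 (by exact_mod_cast h3)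
  have hgle : g q / (q : ℝ) ^ 2 ≤ g q := div_le_self hg0.le (by nlinarith)
  have hform : f q / (q : ℝ) ^ 2 * γ = γ * f q / (q : ℝ) ^ 2 := by ring
  rw [sub_div] at hs
  obtain ⟨p', q', hq', happ⟩ : ∃ (p' : ℤ) (q' : ℕ), q < q' ∧ |α - (p' : ℝ) / q'| < ψ q' := by
    rcases le_total 0 (α - (p : ℝ) / q) with h0 | h0
    · rw [abs_of_nonneg h0] at hs hlt
      refine hgq p hp 1 α ?_
      rw [Units.val_one, Int.cast_one, one_mul, hform, abs_le]
      constructor <;> linarith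
    · rw [abs_of_nonpos h0] at hs hlt
      refine hgq p hp (-1) α ?_
      rw [Units.val_neg, Units.val_one, Int.cast_neg, Int.cast_one, neg_one_mul, neg_mul, hform,
        abs_le]
      constructor <;> linarith
  refine ⟨p', q', by lia, happ.trans_le ?_⟩
  have hq0' : 1 ≤ q' := by lia
  obtain ⟨-, h2, -⟩ := hg q' hq0'
  have h3 := (hf q' hq0').1
  have h4 : f q' / 4 ≤ γ * f q' - g q' := by nlinarith
  exact div_le_div_of_nonneg_right h4 (by positivity)
end

section
/- Let f : ℤ₊ → ℚ ∩ (0,1] be a non-strictly decreasing function. For x ∈ ℤ₊ write f(x) = A(x)/B(x) with A(x) ∈ ℤ₊, B(x) ∈ ℤ₊ and gcd(A(x), B(x)) = 1, and define g_f(x) = f(x)² · f( A(x)·x²/f(x) + 2 ) / (A(x)·x)² (note that A(x)·x²/f(x) + 2 = B(x)·x² + 2 is a positive integer). Let α be a real number such that the inequality |α − p/q| < f(q)/q² has infinitely many solutions in rationals p/q. Then for every ε > 0 the stronger inequality |α − p/q| < ( f(q) − (1−ε)·g_f(q) )/q² also has infinitely many solutions in rationals p/q. -/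
/-- `g_f(x) = f(x)² · f(A(x)x²/f(x) + 2) / (A(x)x)²`, where `f(x) = A(x)/B(x)` in lowest
terms; note `A(x)x²/f(x) + 2 = B(x)x² + 2` is a positive integer. -/
def gAux (f : ℕ → ℚ) (x : ℕ) : ℚ :=
  f x ^ 2 * f ((f x).den * x ^ 2 + 2) / (((f x).num : ℚ) * (x : ℚ)) ^ 2

theorem gAux_nonneg (f : ℕ → ℚ) (hf : ∀ x : ℕ, 1 ≤ x → f x ∈ Set.Ioc (0 : ℚ) 1) (x : ℕ) :
    0 ≤ gAux f x := by
  have := (hf ((f x).den * x ^ 2 + 2) (by lia)).1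
  unfold gAux
  positivity

theorem gAux_div_sq (f : ℕ → ℚ) (x : ℕ) (hx : 0 < x) (hfx : 0 < f x) :
    gAux f x / (x : ℚ) ^ 2 =
      f ((f x).den * x ^ 2 + 2) / (((f x).den * x ^ 2 : ℕ) : ℚ) ^ 2 := by
  have hnum : ((f x).num : ℚ) ≠ 0 := by exact_mod_cast (Rat.num_pos.2 hfx).ne'
  have hden : ((f x).den : ℚ) ≠ 0 := by exact_mod_cast (f x).den_ne_zero
  have hx' : (x : ℚ) ≠ 0 := by positivity
  have hsq : f x ^ 2 = ((f x).num : ℚ) ^ 2 / ((f x).den : ℚ) ^ 2 := by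
    rw [← div_pow, Rat.num_div_den]
  unfold gAux
  rw [hsq]
  push_cast
  field_simp

theorem gAux_le_div_sq (f : ℕ → ℚ) (hf : ∀ x : ℕ, 1 ≤ x → f x ∈ Set.Ioc (0 : ℚ) 1)
    (x : ℕ) (hx : 0 < x) : gAux f x ≤ f x / (x : ℚ) ^ 2 := by
  obtain ⟨h0, h1⟩ := hf x hx
  obtain ⟨k0, k1⟩ := hf ((f x).den * x ^ 2 + 2) (by lia)
  have hnum : (1 : ℚ) ≤ (f x).num := by exact_mod_cast Rat.num_pos.2 h0
  have hx' : (0 : ℚ) < x := by positivity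
  unfold gAux
  apply div_le_div₀ h0.le _ (by positivity) _
  · calc f x ^ 2 * f ((f x).den * x ^ 2 + 2) ≤ f x ^ 2 * 1 := by gcongr
      _ ≤ f x := by nlinarith
  · exact pow_le_pow_left₀ hx'.le (by nlinarith) 2

theorem irrational_of_infinite_approx (α : ℝ) (S : Set ℚ) (hS : S.Infinite)
    (h : ∀ r ∈ S, ∃ (p : ℤ) (q : ℕ), 0 < q ∧ r = (p : ℚ) / (q : ℚ) ∧
      |α - (p : ℝ) / (q : ℝ)| < 1 / (q : ℝ) ^ 2) : Irrational α := by
  rw [← Real.infinite_rat_abs_sub_lt_one_div_den_sq_iff_irrational]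
  refine hS.mono fun r hr => ?_
  obtain ⟨p, q, hq, rfl, hlt⟩ := h r hr
  have hdvd : (((p : ℚ) / (q : ℚ)).den : ℤ) ∣ q := by
    exact_mod_cast Rat.den_dvd p q
  have hle : ((p : ℚ) / (q : ℚ)).den ≤ q := Nat.le_of_dvd hq (by exact_mod_cast hdvd)
  have hpos := ((p : ℚ) / (q : ℚ)).den_pos
  show |α - (((p : ℚ) / (q : ℚ) : ℚ) : ℝ)| < _
  push_cast
  exact hlt.trans_le (by gcongr)

theorem finite_approx_of_den_lt (α : ℝ) (N : ℕ) :
    {r : ℚ | ∃ (p : ℤ) (q : ℕ), 0 < q ∧ q < N ∧ r = (p : ℚ) / (q : ℚ) ∧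
      |α - (p : ℝ) / (q : ℝ)| < 1}.Finite := by
  obtain ⟨M, hM⟩ := exists_nat_gt ((|α| + 1) * N)
  refine (((Set.finite_Icc (-(M : ℤ)) M).prod (Set.finite_Iio N)).image
    (fun z : ℤ × ℕ => (z.1 : ℚ) / (z.2 : ℚ))).subset ?_
  rintro r ⟨p, q, hq, hqN, rfl, hlt⟩
  refine ⟨(p, q), ⟨?_, hqN⟩, rfl⟩
  have hq' : (0 : ℝ) < q := by positivity
  have hqN' : (q : ℝ) ≤ N := by exact_mod_cast hqN.le
  have habs : |(p : ℝ) / q| ≤ |α| + 1 := by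
    have := abs_sub_abs_le_abs_sub ((p : ℝ) / q) α
    rw [abs_sub_comm] at this
    linarith
  rw [abs_div, abs_of_pos hq', div_le_iff₀ hq'] at habs
  have hp : |(p : ℝ)| ≤ M := habs.trans ((by gcongr : _ ≤ (|α| + 1) * (N : ℝ)).trans hM.le)
  exact Set.mem_Icc.2 (abs_le.1 (by exact_mod_cast hp))

/-- A solution of the weak inequality with denominator `q` violating the strong one yields a
solution of the strong inequality with denominator `B(q) q²`. -/
theorem exists_approx_of_not_strong (f : ℕ → ℚ)
    (hf : ∀ x : ℕ, 1 ≤ x → f x ∈ Set.Ioc (0 : ℚ) 1)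
    (hdec : ∀ x y : ℕ, 1 ≤ x → x ≤ y → f y ≤ f x) (α ε : ℝ) (hε : 0 < ε) (hε1 : ε < 1)
    (p : ℤ) (q : ℕ) (hq : 0 < q) (hqε : 1 / (q : ℝ) ^ 2 < ε)
    (hlt : |α - (p : ℝ) / (q : ℝ)| < (f q : ℝ) / (q : ℝ) ^ 2)
    (hge : ((f q : ℝ) - (1 - ε) * (gAux f q : ℝ)) / (q : ℝ) ^ 2 ≤ |α - (p : ℝ) / (q : ℝ)|) :
    ∃ (P : ℤ) (Q : ℕ), q ≤ Q ∧
      |α - (P : ℝ) / (Q : ℝ)| < ((f Q : ℝ) - (1 - ε) * (gAux f Q : ℝ)) / (Q : ℝ) ^ 2 := by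
  have hfq := (hf q hq).1
  have hden := (f q).den_pos
  obtain ⟨Q, hQ⟩ : ∃ Q, Q = (f q).den * q ^ 2 := ⟨_, rfl⟩
  have hqQ : q ≤ Q := by rw [hQ]; nlinarith
  have hQ0 : 0 < Q := hq.trans_le hqQ
  have hq' : (0 : ℝ) < q := by positivity
  have hQ' : (0 : ℝ) < Q := by positivity
  have hden' : (0 : ℝ) < (f q).den := by exact_mod_cast hden
  have hnd : (f q : ℝ) = ((f q).num : ℝ) / ((f q).den : ℝ) := by
    exact_mod_cast (Rat.num_div_den (f q)).symm
  have hg : (gAux f q : ℝ) / (q : ℝ) ^ 2 = (f (Q + 2) : ℝ) / (Q : ℝ) ^ 2 := by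
    have := gAux_div_sq f q hq hfq
    rw [← hQ] at this
    exact_mod_cast this
  have hfQ : (f (Q + 2) : ℝ) ≤ f Q := by exact_mod_cast hdec Q (Q + 2) hQ0 (by lia)
  have hfQ0 : (0 : ℝ) < f Q := by exact_mod_cast (hf Q hQ0).1
  have hgQ : (gAux f Q : ℝ) ≤ (f Q : ℝ) / (Q : ℝ) ^ 2 := by
    exact_mod_cast gAux_le_div_sq f hf Q hQ0
  have hgQ0 : (0 : ℝ) ≤ gAux f Q := by exact_mod_cast gAux_nonneg f hf Q
  have hgε : (gAux f Q : ℝ) < ε * f Q := by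
    have h1 : 1 / (Q : ℝ) ^ 2 < ε := lt_of_le_of_lt (by gcongr) hqε
    calc (gAux f Q : ℝ) ≤ 1 / (Q : ℝ) ^ 2 * f Q := by rwa [one_div_mul_eq_div]
      _ < ε * f Q := by gcongr
  have hfin : (1 - ε) * ((f (Q + 2) : ℝ) / (Q : ℝ) ^ 2) <
      ((f Q : ℝ) - (1 - ε) * (gAux f Q : ℝ)) / (Q : ℝ) ^ 2 := by
    rw [← mul_div_assoc]
    gcongr
    nlinarith
  rw [← hg] at hfin
  have hge' : (f q : ℝ) / (q : ℝ) ^ 2 - (1 - ε) * ((gAux f q : ℝ) / (q : ℝ) ^ 2) ≤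
      |α - (p : ℝ) / (q : ℝ)| := by
    rwa [← mul_div_assoc, ← sub_div]
  have hβ (s : ℤ) : ((p * (f q).den * q + s * (f q).num : ℤ) : ℝ) / (Q : ℝ) =
      (p : ℝ) / q + s * ((f q : ℝ) / (q : ℝ) ^ 2) := by
    rw [hnd, hQ]
    push_cast
    field_simp
  rcases le_total 0 (α - (p : ℝ) / q) with h | h
  · refine ⟨p * (f q).den * q + 1 * (f q).num, Q, hqQ, lt_of_le_of_lt ?_ hfin⟩
    rw [abs_of_nonneg h] at hlt hge'
    rw [hβ, abs_le]
    push_cast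
    constructor <;> linarith
  · refine ⟨p * (f q).den * q + (-1) * (f q).num, Q, hqQ, lt_of_le_of_lt ?_ hfin⟩
    rw [abs_of_nonpos h] at hlt hge'
    rw [hβ, abs_le]
    push_cast
    constructor <;> linarith

/-- Theorem 2: if `f : ℤ₊ → ℚ ∩ (0,1]` is non-strictly decreasing and
`|α − p/q| < f(q)/q²` has infinitely many rational solutions `p/q`, then for every
`ε > 0` so does `|α − p/q| < (f(q) − (1−ε)·g_f(q))/q²`. -/
theorem statement1 (f : ℕ → ℚ) (hf : ∀ x : ℕ, 1 ≤ x → f x ∈ Set.Ioc (0:ℚ) 1)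
    (hdec : ∀ x y : ℕ, 1 ≤ x → x ≤ y → f y ≤ f x) (α : ℝ)
    (hsol : {r : ℚ | ∃ (p : ℤ) (q : ℕ), 0 < q ∧ r = (p : ℚ) / (q : ℚ) ∧
      |α - (p : ℝ) / (q : ℝ)| < (f q : ℝ) / (q : ℝ) ^ 2}.Infinite)
    (ε : ℝ) (hε : 0 < ε) :
    {r : ℚ | ∃ (p : ℤ) (q : ℕ), 0 < q ∧ r = (p : ℚ) / (q : ℚ) ∧
      |α - (p : ℝ) / (q : ℝ)| < ((f q : ℝ) - (1 - ε) * (gAux f q : ℝ)) / (q : ℝ) ^ 2}.Infinite := by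
  have hone : ∀ q : ℕ, 0 < q → (f q : ℝ) / (q : ℝ) ^ 2 ≤ 1 / (q : ℝ) ^ 2 := fun q hq => by
    have : (f q : ℝ) ≤ 1 := by exact_mod_cast (hf q hq).2
    gcongr
  have hg0 : ∀ q : ℕ, (0 : ℝ) ≤ gAux f q := fun q => by exact_mod_cast gAux_nonneg f hf q
  rcases le_or_gt 1 ε with hε1 | hε1
  · refine hsol.mono ?_
    rintro r ⟨p, q, hq, rfl, hlt⟩
    refine ⟨p, q, hq, rfl, hlt.trans_le ?_⟩
    gcongr
    nlinarith [hg0 q]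
  have hirr : Irrational α := by
    refine irrational_of_infinite_approx α _ hsol ?_
    rintro r ⟨p, q, hq, hr, hlt⟩
    exact ⟨p, q, hq, hr, hlt.trans_le (hone q hq)⟩
  intro hfin
  have hlim : Filter.Tendsto (fun n : ℕ => 1 / (n : ℝ) ^ 2) Filter.atTop (nhds 0) := by
    simpa using (tendsto_one_div_atTop_nhds_zero_nat (𝕜 := ℝ)).pow 2
  have hev := ((Set.Finite.eventually_all hfin).2 fun r _ => hlim.eventually_lt_const
    (abs_pos.2 (sub_ne_zero.2 (hirr.ne_rat r)))).and (hlim.eventually_lt_const hε)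
  obtain ⟨N, hN⟩ := Filter.eventually_atTop.1 hev
  obtain ⟨r, ⟨p, q, hq, hr, hlt⟩, hr'⟩ := hsol.exists_notMem_finite (finite_approx_of_den_lt α N)
  have hqN : N ≤ q := by
    by_contra! h
    refine hr' ⟨p, q, hq, h, hr, hlt.trans_le ((hone q hq).trans ?_)⟩
    have : (1 : ℝ) ≤ q := by exact_mod_cast hq
    exact (div_le_one (by positivity)).2 (one_le_pow₀ this)
  have hnot : ∀ (P : ℤ) (Q : ℕ), N ≤ Q → 0 < Q →
      ((f Q : ℝ) - (1 - ε) * (gAux f Q : ℝ)) / (Q : ℝ) ^ 2 ≤ |α - (P : ℝ) / (Q : ℝ)| := by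
    intro P Q hNQ hQ
    by_contra! h
    have h1 := (hN Q hNQ).1 _ ⟨P, Q, hQ, rfl, h⟩
    push_cast at h1
    refine absurd (h1.trans h) (not_lt.2 (le_trans ?_ (hone Q hQ)))
    gcongr
    nlinarith [hg0 Q]
  obtain ⟨P, Q, hqQ, h⟩ := exists_approx_of_not_strong f hf hdec α ε hε hε1 p q hq
    (hN q hqN).2 hlt (hnot p q hqN hq)
  exact absurd h (not_lt.2 (hnot P Q (hqN.trans hqQ) (hq.trans_le hqQ)))
end

section
/- Fix integers m, n ≥ 1 and let f ∈ 𝔉. Then there exists a function g : ℤ₊ → (0,1] such that for every matrix Θ ∈ ℛ the following holds: if the inequality ‖Θq‖ < f(|q|)/|q|^{m/n} has infinitely many solutions in nonzero q ∈ ℤ^m, then the stronger inequality ‖Θq‖ < ( f(|q|) − g(|q|) )/|q|^{m/n} also has infinitely many solutions in nonzero q ∈ ℤ^m. -/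
open scoped BigOperators

/-- `|q| = max_{1 ≤ i ≤ m} |q_i|` for an integer vector `q ∈ ℤ^m`. -/
def vecMax {m : ℕ} (q : Fin m → ℤ) : ℕ :=
  Finset.univ.sup fun i => (q i).natAbs

/-- `‖Θq‖ = min_{p ∈ ℤⁿ} max_{1 ≤ j ≤ n} |(Θq)_j − p_j|`. -/
noncomputable def approxNorm {m n : ℕ} (Θ : Fin n → Fin m → ℝ) (q : Fin m → ℤ) : ℝ :=
  ⨅ p : Fin n → ℤ, ⨆ j : Fin n, |(∑ i, Θ j i * (q i : ℝ)) - (p j : ℝ)|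

/-- Membership in `ℛ`: all entries of the `n × m` matrix lie in `[0,1]`. -/
def memR {m n : ℕ} (Θ : Fin n → Fin m → ℝ) : Prop :=
  ∀ j : Fin n, ∀ i : Fin m, Θ j i ∈ Set.Icc (0:ℝ) 1

/-- Membership in `𝓜^c[f] = ⋃_{Q ∈ ℤ₊} ⋂_{q ∈ ℤ^m, |q| ≥ Q} M_q^c[f]`, where
`M_q^c[f] = ℛ \ {Θ ∈ ℛ : ‖Θq‖ < f(|q|)/(2|q|^{m/n})}`. -/
def memMc (m n : ℕ) (f : ℕ → ℝ) (Θ : Fin n → Fin m → ℝ) : Prop :=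
  memR Θ ∧ ∃ Q : ℕ, 0 < Q ∧ ∀ q : Fin m → ℤ, q ≠ 0 → Q ≤ vecMax q →
    f (vecMax q) / (2 * (vecMax q : ℝ) ^ ((m : ℝ) / n)) ≤ approxNorm Θ q

/-- Membership in the family `𝔉`: `f` is positive-valued on `ℤ₊` and there is `Q = Q[f] ∈ ℤ₊`
such that for every `Θ ∈ 𝓜^c[f]` and every nonzero `q ∈ ℤ^m` with `|q| ≥ Q` one has
`|q|^{m/n} · ‖Θq‖ ≠ f(|q|)`. -/
def memF (m n : ℕ) (f : ℕ → ℝ) : Prop :=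
  (∀ x : ℕ, 1 ≤ x → 0 < f x) ∧
  ∃ Q : ℕ, 0 < Q ∧ ∀ Θ : Fin n → Fin m → ℝ, memMc m n f Θ →
    ∀ q : Fin m → ℤ, q ≠ 0 → Q ≤ vecMax q →
      (vecMax q : ℝ) ^ ((m : ℝ) / n) * approxNorm Θ q ≠ f (vecMax q)

theorem approxNorm_eq_infDist {m n : ℕ} (Θ : Fin n → Fin m → ℝ) (q : Fin m → ℤ) :
    approxNorm Θ q = Metric.infDist (fun j => ∑ i, Θ j i * (q i : ℝ))
      (Set.range fun (p : Fin n → ℤ) (j : Fin n) => (p j : ℝ)) := by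
  have h (x y : Fin n → ℝ) : dist x y = ⨆ j, |x j - y j| :=
    le_antisymm
      ((dist_pi_le_iff (Real.iSup_nonneg fun _ => abs_nonneg _)).2 fun j =>
        le_ciSup (f := fun j => |x j - y j|) (Set.finite_range _).bddAbove j)
      (Real.iSup_le (fun j => dist_le_pi_dist x y j) dist_nonneg)
  rw [Metric.infDist_eq_iInf, iInf_range' (fun y => dist (fun j => ∑ i, Θ j i * (q i : ℝ)) y)]
  simp only [h, approxNorm]

theorem continuous_approxNorm {m n : ℕ} (q : Fin m → ℤ) :
    Continuous fun Θ : Fin n → Fin m → ℝ => approxNorm Θ q := by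
  simp only [approxNorm_eq_infDist]
  exact (Metric.continuous_infDist_pt _).comp (by fun_prop)

theorem finite_setOf_vecMax_le (m N : ℕ) : {q : Fin m → ℤ | vecMax q ≤ N}.Finite := by
  refine (Set.finite_Icc (fun _ : Fin m => -(N : ℤ)) fun _ => (N : ℤ)).subset fun q hq => ?_
  have h (i : Fin m) : (q i).natAbs ≤ N :=
    (Finset.le_sup (f := fun i => (q i).natAbs) (Finset.mem_univ i)).trans hq
  exact ⟨fun i => by have := h i; dsimp only; omega, fun i => by have := h i; dsimp only; omega⟩

theorem vecMax_pos {m : ℕ} {q : Fin m → ℤ} (hq : q ≠ 0) : 0 < vecMax q := by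
  obtain ⟨i, hi⟩ := Function.ne_iff.1 hq
  exact (Int.natAbs_pos.2 hi).trans_le
    (Finset.le_sup (f := fun i => (q i).natAbs) (Finset.mem_univ i))

/-- The set `⋂_{|q| ≥ Q} M_q^c[f]`. -/
def badSet (m n : ℕ) (f : ℕ → ℝ) (Q : ℕ) : Set (Fin n → Fin m → ℝ) :=
  {Θ | memR Θ ∧ ∀ q : Fin m → ℤ, q ≠ 0 → Q ≤ vecMax q →
    f (vecMax q) / (2 * (vecMax q : ℝ) ^ ((m : ℝ) / n)) ≤ approxNorm Θ q}

theorem badSet_mono (m n : ℕ) (f : ℕ → ℝ) : Monotone (badSet m n f) :=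
  fun _ _ h _ hΘ => ⟨hΘ.1, fun q hq hQ => hΘ.2 q hq (h.trans hQ)⟩

theorem isCompact_badSet (m n : ℕ) (f : ℕ → ℝ) (Q : ℕ) : IsCompact (badSet m n f Q) := by
  have hR : IsCompact {Θ : Fin n → Fin m → ℝ | memR Θ} := by
    convert isCompact_univ_pi fun _ : Fin n => isCompact_univ_pi fun _ : Fin m =>
      isCompact_Icc (a := (0 : ℝ)) (b := 1) using 1
    ext Θ
    simp [memR, Pi.le_def, forall_and]
  refine hR.inter_right (t := {Θ | ∀ q : Fin m → ℤ, q ≠ 0 → Q ≤ vecMax q →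
    f (vecMax q) / (2 * (vecMax q : ℝ) ^ ((m : ℝ) / n)) ≤ approxNorm Θ q}) ?_
  simp only [Set.ofPred_forall]
  exact isClosed_iInter fun q => isClosed_iInter fun _ => isClosed_iInter fun _ =>
    isClosed_le continuous_const (continuous_approxNorm q)

open Filter Topology in
theorem eventually_gap {X : Type*} [TopologicalSpace X] {K : Set X} (hK : IsCompact K)
    {h : X → ℝ} (hc : Continuous h) {c : ℝ} (hne : ∀ x ∈ K, h x ≠ c) :
    ∀ᶠ ε in 𝓝[>] (0 : ℝ), ∀ x ∈ K, h x < c → h x < c - ε := by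
  obtain ⟨δ, hδ, hle⟩ := hK.exists_forall_le' (f := fun x => |h x - c|) (a := 0)
    (by fun_prop) fun x hx => abs_pos.2 (sub_ne_zero.2 (hne x hx))
  filter_upwards [Ioo_mem_nhdsGT hδ] with ε hε x hx hlt
  have := hle x hx
  rw [abs_of_neg (sub_neg.2 hlt)] at this
  linarith [hε.2]

open Filter Topology in
theorem exists_gap {m n : ℕ} {f : ℕ → ℝ} {Q : ℕ} (hQ : ∀ Θ : Fin n → Fin m → ℝ, memMc m n f Θ →
      ∀ q : Fin m → ℤ, q ≠ 0 → Q ≤ vecMax q →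
        (vecMax q : ℝ) ^ ((m : ℝ) / n) * approxNorm Θ q ≠ f (vecMax q))
    {x : ℕ} (hx : 1 ≤ x) (hfx : 0 < f x) :
    ∃ ε ∈ Set.Ioc (0 : ℝ) 1, ε ≤ f x / 2 ∧ (Q ≤ x → ∀ q : Fin m → ℤ, q ≠ 0 → vecMax q = x →
      ∀ Θ ∈ badSet m n f x, (x : ℝ) ^ ((m : ℝ) / n) * approxNorm Θ q < f x →
        (x : ℝ) ^ ((m : ℝ) / n) * approxNorm Θ q < f x - ε) := by
  have hfin : {q : Fin m → ℤ | q ≠ 0 ∧ vecMax q = x}.Finite :=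
    (finite_setOf_vecMax_le m x).subset fun q hq => hq.2.le
  have hgap : ∀ᶠ ε in 𝓝[>] (0 : ℝ), Q ≤ x → ∀ q ∈ {q : Fin m → ℤ | q ≠ 0 ∧ vecMax q = x},
      ∀ Θ ∈ badSet m n f x, (x : ℝ) ^ ((m : ℝ) / n) * approxNorm Θ q < f x →
        (x : ℝ) ^ ((m : ℝ) / n) * approxNorm Θ q < f x - ε := by
    rw [eventually_imp_distrib_left]
    refine fun hQx => (eventually_all_finite hfin).2 ?_
    rintro q ⟨hq, rfl⟩
    exact eventually_gap (isCompact_badSet m n f _) ((continuous_approxNorm q).const_mul _)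
      fun Θ hΘ => hQ Θ ⟨hΘ.1, _, hx, hΘ.2⟩ q hq hQx
  obtain ⟨ε, hε, h1, h2⟩ :=
    (hgap.and (inter_mem (Ioc_mem_nhdsGT one_pos) (Ioc_mem_nhdsGT (half_pos hfx)))).exists
  exact ⟨ε, h1, h2.2, fun hQx q hq hqx => hε hQx q ⟨hq, hqx⟩⟩

/-- Theorem 3: if `f ∈ 𝔉`, there is `g : ℤ₊ → (0,1]` such that for every `Θ ∈ ℛ`,
if `‖Θq‖ < f(|q|)/|q|^{m/n}` has infinitely many solutions in nonzero `q ∈ ℤ^m`, then so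
does `‖Θq‖ < (f(|q|) − g(|q|))/|q|^{m/n}`. -/
theorem statement2 (m n : ℕ) (hm : 1 ≤ m) (hn : 1 ≤ n) (f : ℕ → ℝ) (hf : memF m n f) :
    ∃ g : ℕ → ℝ, (∀ x : ℕ, 1 ≤ x → g x ∈ Set.Ioc (0:ℝ) 1) ∧
      ∀ Θ : Fin n → Fin m → ℝ, memR Θ →
        {q : Fin m → ℤ | q ≠ 0 ∧
          approxNorm Θ q < f (vecMax q) / (vecMax q : ℝ) ^ ((m : ℝ) / n)}.Infinite →
        {q : Fin m → ℤ | q ≠ 0 ∧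
          approxNorm Θ q <
            (f (vecMax q) - g (vecMax q)) / (vecMax q : ℝ) ^ ((m : ℝ) / n)}.Infinite := by
  obtain ⟨hpos, Q, -, hQ⟩ := hf
  choose! g hg01 hgf hg using fun x (hx : 1 ≤ x) => exists_gap hQ hx (hpos x hx)
  refine ⟨g, hg01, fun Θ hΘ hinf => ?_⟩
  have hpow {q : Fin m → ℤ} (hq : q ≠ 0) : 0 < (vecMax q : ℝ) ^ ((m : ℝ) / n) :=
    Real.rpow_pos_of_pos (Nat.cast_pos.2 (vecMax_pos hq)) _
  by_cases hMc : memMc m n f Θ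
  · obtain ⟨-, Q', -, hQ'⟩ := hMc
    refine (hinf.sdiff (finite_setOf_vecMax_le m (max Q Q'))).mono ?_
    rintro q ⟨⟨hq, hlt⟩, hbig⟩
    obtain ⟨h1, h2⟩ : Q < vecMax q ∧ Q' < vecMax q := by simpa using hbig
    rw [lt_div_iff₀' (hpow hq)] at hlt
    exact ⟨hq, (lt_div_iff₀' (hpow hq)).2 (hg _ (vecMax_pos hq) h1.le q hq rfl Θ
      (badSet_mono m n f h2.le ⟨hΘ, hQ'⟩) hlt)⟩
  · intro hfin
    obtain ⟨N, hN⟩ := (hfin.image vecMax).bddAbove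
    refine hMc ⟨hΘ, N + 1, N.succ_pos, fun q hq hNq => ?_⟩
    by_contra! hlt
    refine (Nat.lt_of_succ_le hNq).not_ge (hN ⟨q, ⟨hq, hlt.trans_le ?_⟩, rfl⟩)
    rw [← div_div]
    have := hgf _ (vecMax_pos hq)
    exact div_le_div_of_nonneg_right (by linarith) (hpow hq).le
end

section
/- Let m = n = 1. Then for any function f : ℤ₊ → (0,1] there exists a real number γ ∈ (0,1) such that the function γ·f belongs to the family 𝔉. -/
open scoped BigOperators

theorem vecMax_fin_one (q : Fin 1 → ℤ) : vecMax q = (q 0).natAbs := by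
  simp [vecMax]

theorem approxNorm_fin_one (Θ : Fin 1 → Fin 1 → ℝ) (q : Fin 1 → ℤ) :
    approxNorm Θ q = |Θ 0 0 * (q 0 : ℝ) - round (Θ 0 0 * (q 0 : ℝ))| := by
  simp only [approxNorm, ciSup_unique, Fin.default_eq_zero, Finset.univ_unique,
    Finset.sum_singleton]
  apply le_antisymm
  · exact ciInf_le ⟨0, by rintro _ ⟨p, rfl⟩; exact abs_nonneg _⟩
      (fun _ : Fin 1 => round (Θ 0 0 * (q 0 : ℝ)))
  · exact le_ciInf fun p => round_le _ _

/-- The reals `θ` with `|θ k - p| < ψ k` for some integer `p` and some positive `k ≥ N`. -/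
def approximableBeyond (ψ : ℕ → ℝ) (N : ℕ) : Set ℝ :=
  {θ | ∃ k : ℕ, 0 < k ∧ N ≤ k ∧ ∃ p : ℤ, |θ * k - p| < ψ k}

theorem isOpen_approximableBeyond (ψ : ℕ → ℝ) (N : ℕ) : IsOpen (approximableBeyond ψ N) := by
  have h : approximableBeyond ψ N =
      ⋃ k : ℕ, ⋃ _ : 0 < k, ⋃ _ : N ≤ k, ⋃ p : ℤ, {θ : ℝ | |θ * k - p| < ψ k} := by
    ext θ
    simp only [approximableBeyond, Set.mem_ofPred_eq, Set.mem_iUnion, exists_prop]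
  rw [h]
  exact isOpen_iUnion fun k => isOpen_iUnion fun _ => isOpen_iUnion fun _ =>
    isOpen_iUnion fun p => isOpen_lt (by fun_prop) continuous_const

theorem dense_approximableBeyond {ψ : ℕ → ℝ} (hψ : ∀ k, 0 < k → 0 < ψ k) (N : ℕ) :
    Dense (approximableBeyond ψ N) := by
  refine Rat.denseRange_cast.mono ?_
  rintro _ ⟨r, rfl⟩
  have hk : 0 < r.den * (N + 1) := Nat.mul_pos r.pos N.succ_pos
  refine ⟨r.den * (N + 1), hk, ?_, r.num * (N + 1), ?_⟩
  · nlinarith [r.pos]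
  · have h : (r : ℝ) * r.den = r.num := by exact_mod_cast Rat.mul_den_eq_num r
    have h0 : (r : ℝ) * ((r.den * (N + 1) : ℕ) : ℝ) - ((r.num * (N + 1) : ℤ) : ℝ) = 0 := by
      push_cast
      rw [← mul_assoc, h, sub_self]
    rw [h0, abs_zero]
    exact hψ _ hk

theorem dense_preimage_affine {s : Set ℝ} (hs : Dense s) {a : ℝ} (ha : a ≠ 0) (b : ℝ) :
    Dense ((fun x => a * x + b) ⁻¹' s) :=
  hs.preimage (affineHomeomorph a b ha).isOpenMap

/-- By Baire's theorem, some `γ ∈ (1/2, 1)` makes every `(p + s γ f(|q|)) / q` infinitely often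
`ψ`-approximable. -/
theorem exists_forall_mem_approximableBeyond {f ψ : ℕ → ℝ} (hf : ∀ k, 0 < k → 0 < f k)
    (hψ : ∀ k, 0 < k → 0 < ψ k) :
    ∃ γ ∈ Set.Ioo (1 / 2 : ℝ) 1, ∀ q p s : ℤ, q ≠ 0 → s ≠ 0 → ∀ N : ℕ,
      s * f q.natAbs / q * γ + p / q ∈ approximableBeyond ψ N := by
  let ι := {i : ℤ × ℤ × ℤ × ℕ // i.1 ≠ 0 ∧ i.2.2.1 ≠ 0}
  let U : ι → Set ℝ := fun i =>
    (fun x : ℝ => (i.1.2.2.1 * f i.1.1.natAbs / i.1.1 : ℝ) * x + i.1.2.1 / i.1.1) ⁻¹'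
      approximableBeyond ψ i.1.2.2.2
  have hU : Dense (⋂ i, U i) := by
    refine dense_iInter_of_isOpen
      (fun i => (isOpen_approximableBeyond ψ _).preimage (by fun_prop)) fun i => ?_
    refine dense_preimage_affine (dense_approximableBeyond hψ _) ?_ _
    have h1 : ((i.1.1 : ℤ) : ℝ) ≠ 0 := Int.cast_ne_zero.2 i.2.1
    have h2 : ((i.1.2.2.1 : ℤ) : ℝ) ≠ 0 := Int.cast_ne_zero.2 i.2.2
    exact div_ne_zero (mul_ne_zero h2 (hf _ (Int.natAbs_pos.2 i.2.1)).ne') h1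
  obtain ⟨γ, hγ, hγU⟩ := hU.exists_mem_open isOpen_Ioo
    (⟨3 / 4, by norm_num, by norm_num⟩ : (Set.Ioo (1 / 2 : ℝ) 1).Nonempty)
  exact ⟨γ, hγU, fun q p s hq hs N => Set.mem_iInter.1 hγ ⟨(q, p, s, N), hq, hs⟩⟩

/-- Lemma 2: for `m = n = 1`, for any `f : ℤ₊ → (0,1]` there is `γ ∈ (0,1)` with
`γ·f ∈ 𝔉`. -/
theorem statement4 (f : ℕ → ℝ) (hf : ∀ x : ℕ, 1 ≤ x → f x ∈ Set.Ioc (0:ℝ) 1) :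
    ∃ γ ∈ Set.Ioo (0:ℝ) 1, memF 1 1 (fun x : ℕ => γ * f x) := by
  have hpos : ∀ k, 0 < k → 0 < f k := fun k hk => (hf k hk).1
  obtain ⟨γ, ⟨hγ, hγ1⟩, h⟩ := exists_forall_mem_approximableBeyond
    (f := fun k => f k / k) (ψ := fun k => f k / (4 * k))
    (fun k hk => div_pos (hpos k hk) (by positivity))
    (fun k hk => div_pos (hpos k hk) (by positivity))
  have hγ0 : 0 < γ := by linarith
  refine ⟨γ, ⟨hγ0, hγ1⟩, fun x hx => mul_pos hγ0 (hpos x hx), 1, one_pos, ?_⟩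
  rintro Θ ⟨-, Q, -, hQ⟩ q hq - heq
  have hq0 : q 0 ≠ 0 := fun h0 => hq (by ext i; rw [Subsingleton.elim i 0, h0]; rfl)
  have hqR : ((q 0 : ℤ) : ℝ) ≠ 0 := Int.cast_ne_zero.2 hq0
  have hexp : (((1 : ℕ) : ℝ) / ((1 : ℕ) : ℝ)) = 1 := by norm_num
  simp only [hexp, Real.rpow_one, vecMax_fin_one, approxNorm_fin_one] at heq hQ
  set p := round (Θ 0 0 * (q 0 : ℝ))
  set n := (q 0).natAbs with hn
  have hnR : (0 : ℝ) < n := Nat.cast_pos.2 (Int.natAbs_pos.2 hq0)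
  have habs : |Θ 0 0 * (q 0 : ℝ) - p| = f n / n * γ := by
    field_simp
    linarith
  have hΘ : ∃ s : ℤ, s ≠ 0 ∧ Θ 0 0 = s * (f n / n) / q 0 * γ + p / q 0 := by
    have hsolve : ∀ s : ℝ, Θ 0 0 * (q 0 : ℝ) - p = s * (f n / n * γ) →
        Θ 0 0 = s * (f n / n) / q 0 * γ + p / q 0 := fun s hs => by
      rw [eq_div_of_mul_eq hqR (sub_eq_iff_eq_add.1 hs)]
      ring
    rcases eq_or_eq_neg_of_abs_eq habs with h1 | h1
    · exact ⟨1, one_ne_zero, hsolve _ (by rw [h1]; simp)⟩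
    · exact ⟨-1, by decide, hsolve _ (by rw [h1]; simp)⟩
  obtain ⟨s, hs, hΘs⟩ := hΘ
  obtain ⟨k, hk, hQk, p', hp'⟩ := h (q 0) p s hq0 hs Q
  rw [← hn, ← hΘs] at hp'
  have hkq : (fun _ : Fin 1 => (k : ℤ)) ≠ 0 := fun h0 =>
    hk.ne' (by simpa using congrFun h0 0)
  have hle := hQ (fun _ => (k : ℤ)) hkq (by simpa using hQk)
  simp only [Int.natAbs_natCast, Int.cast_natCast] at hle
  have hkR : (0 : ℝ) < k := Nat.cast_pos.2 hk
  have hlt : f k / (4 * k) < γ * f k / (2 * k) := by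
    rw [div_lt_div_iff₀ (by positivity) (by positivity)]
    nlinarith [mul_pos (mul_pos (hpos k hk) hkR) (sub_pos.2 hγ)]
  linarith [round_le (Θ 0 0 * (k : ℝ)) p']
end

section
/- Let m ≥ 1 be an integer, let θ = (θ₁,…,θ_m) ∈ ℝ^m be a real vector, and let h : ℤ₊ → ℚ ∩ (0,1] be a function taking only positive rational values with h(x) → 0 as x → ∞. Then there is no infinite set 𝒬 ⊂ ℤ^{m+1} of integer vectors q̄ = (q₀, q₁, …, q_m) such that |θ₁q₁ + … + θ_m q_m + q₀| = h( max_{1≤i≤m} |q_i| ) for every q̄ ∈ 𝒬. -/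
/-- A `ℤ`-linear map that takes rational values on a finitely generated submodule has
bounded denominators there. -/
theorem exists_common_denominator {M : Type*} [AddCommGroup M] (L : M →ₗ[ℤ] ℝ)
    (N : Submodule ℤ M) (hN : N.FG) (hrat : ∀ x ∈ N, ∃ r : ℚ, L x = r) :
    ∃ d : ℕ, 0 < d ∧ ∀ x ∈ N, ∃ z : ℤ, (d : ℝ) * L x = z := by
  induction N, hN using Submodule.fg_induction with
  | singleton g =>
    obtain ⟨r, hr⟩ := hrat g (Submodule.mem_span_singleton_self g)
    refine ⟨r.den, r.den_pos, fun x hx => ?_⟩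
    obtain ⟨k, rfl⟩ := Submodule.mem_span_singleton.mp hx
    refine ⟨k * r.num, ?_⟩
    have hden : (r.den : ℝ) * (r : ℝ) = r.num := by
      exact_mod_cast Rat.den_mul_eq_num r
    rw [map_smul, hr, zsmul_eq_mul, Int.cast_mul, ← hden]
    ring
  | sup N₁ N₂ _ _ ih₁ ih₂ =>
    obtain ⟨d₁, hd₁, h₁⟩ := ih₁ fun x hx => hrat x (Submodule.mem_sup_left hx)
    obtain ⟨d₂, hd₂, h₂⟩ := ih₂ fun x hx => hrat x (Submodule.mem_sup_right hx)
    refine ⟨d₁ * d₂, Nat.mul_pos hd₁ hd₂, fun x hx => ?_⟩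
    obtain ⟨y, hy, z, hz, rfl⟩ := Submodule.mem_sup.mp hx
    obtain ⟨a, ha⟩ := h₁ y hy
    obtain ⟨b, hb⟩ := h₂ z hz
    refine ⟨d₂ * a + d₁ * b, ?_⟩
    push_cast
    rw [map_add, ← ha, ← hb]
    ring

/-- The affine form `q̄ ↦ θ₁q₁ + … + θ_m q_m + q₀`, as a `ℤ`-linear map on `ℤ^{m+1}`. -/
noncomputable def affineForm {m : ℕ} (θ : Fin m → ℝ) : ℤ × (Fin m → ℤ) →ₗ[ℤ] ℝ :=
  (AddMonoidHom.mk' (fun q : ℤ × (Fin m → ℤ) => (∑ i, θ i * (q.2 i : ℝ)) + (q.1 : ℝ))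
    (fun a b => by
      simp only [Prod.snd_add, Prod.fst_add, Pi.add_apply, Int.cast_add, mul_add,
        Finset.sum_add_distrib]
      ring)).toIntLinearMap

theorem affineForm_apply {m : ℕ} (θ : Fin m → ℝ) (q : ℤ × (Fin m → ℤ)) :
    affineForm θ q = (∑ i, θ i * (q.2 i : ℝ)) + (q.1 : ℝ) := rfl

theorem natAbs_le_vecMax {m : ℕ} (q : Fin m → ℤ) (i : Fin m) : (q i).natAbs ≤ vecMax q :=
  Finset.le_sup (f := fun i => (q i).natAbs) (Finset.mem_univ i)

/-- Only finitely many integer vectors have bounded `q₁, …, q_m` and bounded affine form. -/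
theorem finite_affineForm_le {m : ℕ} (θ : Fin m → ℝ) (X : ℕ) (C : ℝ) :
    {q : ℤ × (Fin m → ℤ) | vecMax q.2 ≤ X ∧ |affineForm θ q| ≤ C}.Finite := by
  obtain ⟨B, hB⟩ := exists_nat_ge (C + ∑ i, |θ i| * X)
  refine ((Set.finite_Icc (-B : ℤ) B).prod
    (Set.finite_Icc (fun _ : Fin m => (-X : ℤ)) (fun _ => X))).subset ?_
  rintro q ⟨hX, hC⟩
  have hq (i : Fin m) : |q.2 i| ≤ X := by
    have := (natAbs_le_vecMax q.2 i).trans hX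
    rw [Int.abs_eq_natAbs]
    exact_mod_cast this
  have hsum : |∑ i, θ i * (q.2 i : ℝ)| ≤ ∑ i, |θ i| * X := by
    refine (Finset.abs_sum_le_sum_abs _ _).trans (Finset.sum_le_sum fun i _ => ?_)
    rw [abs_mul]
    exact mul_le_mul_of_nonneg_left (by exact_mod_cast hq i) (abs_nonneg _)
  have hq₀ : |q.1| ≤ B := by
    have : |(q.1 : ℝ)| ≤ B := by
      rw [affineForm_apply] at hC
      rw [abs_le] at hC hsum ⊢
      constructor <;> linarith [hC.1, hC.2, hsum.1, hsum.2]
    exact_mod_cast this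
  exact ⟨abs_le.mp hq₀, fun i => (abs_le.mp (hq i)).1, fun i => (abs_le.mp (hq i)).2⟩

/-- There is no real vector `θ ∈ ℝ^m` and infinite set `𝒬 ⊂ ℤ^{m+1}` of vectors
`q̄ = (q₀, q₁, …, q_m)` with `|θ₁q₁ + … + θ_m q_m + q₀| = h(max_i |q_i|)` for all
`q̄ ∈ 𝒬`, when `h : ℤ₊ → ℚ ∩ (0,1]` takes positive rational values and tends to `0`. -/
theorem statement6 (m : ℕ) (hm : 1 ≤ m) (θ : Fin m → ℝ) (h : ℕ → ℚ)
    (hh : ∀ x : ℕ, 1 ≤ x → h x ∈ Set.Ioc (0:ℚ) 1)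
    (hlim : Filter.Tendsto (fun x : ℕ => (h x : ℝ)) Filter.atTop (nhds 0)) :
    ¬ ∃ 𝒬 : Set (ℤ × (Fin m → ℤ)), 𝒬.Infinite ∧
      ∀ qbar ∈ 𝒬,
        |(∑ i, θ i * (qbar.2 i : ℝ)) + (qbar.1 : ℝ)| = (h (vecMax qbar.2) : ℝ) := by
  rintro ⟨𝒬, hinf, hQ⟩
  let Γ : Submodule ℤ (ℤ × (Fin m → ℤ)) :=
    ((Rat.castHom ℝ).toAddMonoidHom.toIntLinearMap.range).comap (affineForm θ)
  obtain ⟨d, hd, hΓ⟩ := exists_common_denominator (affineForm θ) Γ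
    (IsNoetherian.noetherian Γ) (fun x hx => by
      obtain ⟨r, hr⟩ := hx
      exact ⟨r, hr.symm⟩)
  have hd' : (0 : ℝ) < d := by exact_mod_cast hd
  obtain ⟨X, hX⟩ := Filter.eventually_atTop.mp
    (hlim.eventually_lt_const (inv_pos.mpr hd'))
  obtain ⟨q, hq, hqX⟩ : ∃ q ∈ 𝒬, X < vecMax q.2 := by
    by_contra! hle
    refine hinf ((finite_affineForm_le θ X (∑ x ∈ Finset.range (X + 1), |(h x : ℝ)|)).subset
      fun q hq => ⟨hle q hq, ?_⟩)
    rw [affineForm_apply, hQ q hq]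
    exact (le_abs_self _).trans
      (Finset.single_le_sum (f := fun x => |(h x : ℝ)|) (fun _ _ => abs_nonneg _)
        (Finset.mem_range.mpr (Nat.lt_succ_of_le (hle q hq))))
  have hval : |affineForm θ q| = (h (vecMax q.2) : ℝ) := hQ q hq
  have hpos : (0 : ℝ) < h (vecMax q.2) := by exact_mod_cast (hh _ (by omega)).1
  have hmem : q ∈ Γ := by
    rcases eq_or_eq_neg_of_abs_eq hval with hv | hv
    · exact ⟨h (vecMax q.2), hv.symm⟩
    · refine ⟨-h (vecMax q.2), ?_⟩
      rw [hv]
      exact Rat.cast_neg _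
  obtain ⟨z, hz⟩ := hΓ q hmem
  have habs : |(z : ℝ)| = d * h (vecMax q.2) := by
    rw [← hz, abs_mul, hval, abs_of_pos hd']
  have hzpos : (0 : ℝ) < |(z : ℝ)| := habs ▸ mul_pos hd' hpos
  have hzlt : |(z : ℝ)| < 1 := by
    rw [habs, ← mul_inv_cancel₀ hd'.ne']
    exact mul_lt_mul_of_pos_left (hX _ hqX.le) hd'
  have hzpos' : 0 < |z| := by exact_mod_cast hzpos
  have hzlt' : |z| < 1 := by exact_mod_cast hzlt
  omega
end

section
/- Fix integers m, n ≥ 1, a function f : ℤ₊ → (0,1], and a positive integer Q. Then the set 𝒩_Q = ⋂_{q ∈ ℤ^m, |q| ≥ Q} { Θ ∈ ℛ : ‖Θq‖ ≥ f(|q|)/|q|^{m/n} } is nowhere dense in ℛ (with the topology induced from the space of real n×m matrices). -/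
open scoped BigOperators

lemma vecMax_const {m : ℕ} (hm : 1 ≤ m) (N : ℕ) : vecMax (fun _ : Fin m => (N : ℤ)) = N := by
  have : Nonempty (Fin m) := ⟨⟨0, hm⟩⟩
  simp [vecMax, Finset.sup_const Finset.univ_nonempty]

lemma approxNorm_le {m n : ℕ} {Θ : Fin n → Fin m → ℝ} {q : Fin m → ℤ} (p : Fin n → ℤ) {c : ℝ}
    (hc : 0 ≤ c) (h : ∀ j, |(∑ i, Θ j i * (q i : ℝ)) - (p j : ℝ)| ≤ c) :
    approxNorm Θ q ≤ c := by
  refine (ciInf_le ⟨0, ?_⟩ p).trans (Real.iSup_le h hc)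
  rintro _ ⟨p, rfl⟩
  exact Real.iSup_nonneg fun j => abs_nonneg _

/-- The matrix obtained from `T` by rounding each entry down to a multiple of `1 / N`. -/
noncomputable def roundDown {m n : ℕ} (T : Fin n → Fin m → ℝ) (N : ℕ) : Fin n → Fin m → ℝ :=
  fun j i => (⌊T j i * N⌋₊ : ℝ) / N

lemma memR_roundDown {m n : ℕ} {T : Fin n → Fin m → ℝ} (hT : memR T) (N : ℕ) :
    memR (roundDown T N) := by
  intro j i
  refine ⟨by unfold roundDown; positivity, div_le_one_of_le₀ ?_ N.cast_nonneg⟩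
  exact (Nat.floor_le (mul_nonneg (hT j i).1 N.cast_nonneg)).trans
    (mul_le_of_le_one_left N.cast_nonneg (hT j i).2)

lemma tendsto_roundDown {m n : ℕ} {T : Fin n → Fin m → ℝ} (hT : memR T) :
    Filter.Tendsto (roundDown T) Filter.atTop (nhds T) := by
  refine tendsto_pi_nhds.2 fun j => tendsto_pi_nhds.2 fun i => ?_
  exact (tendsto_nat_floor_mul_div_atTop (hT j i).1).comp tendsto_natCast_atTop_atTop

/-- The set `𝒩_Q = ⋂_{q ∈ ℤ^m, |q| ≥ Q} {Θ ∈ ℛ : ‖Θq‖ ≥ f(|q|)/|q|^{m/n}}` is nowhere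
dense in `ℛ` (with the subspace topology from the space of real `n × m` matrices). -/
theorem statement7 (m n : ℕ) (hm : 1 ≤ m) (hn : 1 ≤ n) (f : ℕ → ℝ)
    (hf : ∀ x : ℕ, 1 ≤ x → f x ∈ Set.Ioc (0:ℝ) 1) (Q : ℕ) (hQ : 0 < Q) :
    IsNowhereDense {Θ : {T : Fin n → Fin m → ℝ // memR T} |
      ∀ q : Fin m → ℤ, q ≠ 0 → Q ≤ vecMax q →
        f (vecMax q) / (vecMax q : ℝ) ^ ((m : ℝ) / n) ≤ approxNorm Θ.1 q} := by
  rw [IsNowhereDense, Set.eq_empty_iff_forall_notMem]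
  intro T hT
  have hlim : Filter.Tendsto
      (fun N => (⟨roundDown T.1 N, memR_roundDown T.2 N⟩ : {T : Fin n → Fin m → ℝ // memR T}))
      Filter.atTop (nhds T) := tendsto_subtype_rng.2 (tendsto_roundDown T.2)
  obtain ⟨N, hN, hQN⟩ := ((hlim.eventually (isOpen_interior.mem_nhds hT)).and
    (Filter.eventually_ge_atTop Q)).exists
  have hN0 : 0 < N := hQ.trans_le hQN
  have hNR : (0 : ℝ) < N := Nat.cast_pos.2 hN0
  set q : Fin m → ℤ := fun _ => (N : ℤ)
  have hqN : vecMax q = N := vecMax_const hm N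
  have hq0 : q ≠ 0 := fun h => hN0.ne' (by simpa [q] using congrFun h ⟨0, hm⟩)
  set c : ℝ := f N / (N : ℝ) ^ ((m : ℝ) / n)
  have hc : 0 < c := div_pos (hf N hN0).1 (Real.rpow_pos_of_pos hNR _)
  let p : Fin n → ℤ := fun j => ∑ i, (⌊T.1 j i * N⌋₊ : ℤ)
  let V : Set {T : Fin n → Fin m → ℝ // memR T} :=
    {Θ | ∀ j, |(∑ i, Θ.1 j i * (q i : ℝ)) - (p j : ℝ)| < c / 2}
  have hcoord (j : Fin n) (i : Fin m) :
      Continuous fun Θ : {T : Fin n → Fin m → ℝ // memR T} => Θ.1 j i :=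
    (continuous_apply_apply j i).comp continuous_subtype_val
  have hV : IsOpen V := by
    simp only [V, Set.ofPred_forall]
    exact isOpen_iInter_of_finite fun j => isOpen_lt
      (((continuous_finsetSum _ fun i _ => (hcoord j i).mul continuous_const).sub
        continuous_const).abs) continuous_const
  have hNV : ⟨roundDown T.1 N, memR_roundDown T.2 N⟩ ∈ V := by
    intro j
    simpa [roundDown, q, p, hNR.ne'] using hc
  obtain ⟨Θ, hΘV, hΘ⟩ := mem_closure_iff.1 (interior_subset hN) V hV hNV
  have hlower := hΘ q hq0 (by rwa [hqN])
  rw [hqN] at hlower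
  have hupper := approxNorm_le p (half_pos hc).le fun j => (hΘV j).le
  linarith
end
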